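/- arXiv:1609.02714 — 3 statements merged into one kernel-verified Lean document; each statement's English description precedes it below -/
import Mathlib

section
/- Let (W,S) be a Coxeter system and 𝕂 a commutative ring. On the free 𝕂-module 𝒩 with basis {n_w : w ∈ W}, the bilinear product defined on basis elements by n_w n_{w'} := n_{ww'} if ℓ(ww') = ℓ(w) + ℓ(w'), and n_w n_{w'} := 0 otherwise, is associative, and n_e (e the identity of W) is a two-sided unit; hence 𝒩 is an associative unital 𝕂-algebra (the nil-Hecke algebra of (W,S)). -/
/-- Length-additivity of `(u, v)` and `(u * v, w)` is equivalent to that of `(v, w)` and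
`(u, v * w)`. -/
theorem CoxeterSystem.length_mul_mul_additive_iff {B W : Type*} [Group W] {M : CoxeterMatrix B}
    (cs : CoxeterSystem M W) (u v w : W) :
    (cs.length (u * v) = cs.length u + cs.length v ∧
        cs.length (u * v * w) = cs.length (u * v) + cs.length w) ↔
      (cs.length (v * w) = cs.length v + cs.length w ∧
        cs.length (u * (v * w)) = cs.length u + cs.length (v * w)) := by
  have h₁ := cs.length_mul_le u v
  have h₂ := cs.length_mul_le v w
  have h₃ := cs.length_mul_le (u * v) w
  have h₄ := cs.length_mul_le u (v * w)
  rw [← mul_assoc] at h₄ ⊢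
  omega

/-- **The nil-Hecke algebra of a Coxeter system.**
On the free `𝕂`-module with basis `{n_w : w ∈ W}` (modelled as `W →₀ 𝕂`), the bilinear
product determined on basis elements by `n_w * n_w' = n_(w*w')` if
`ℓ(w*w') = ℓ(w) + ℓ(w')` and `0` otherwise, is associative and has `n_e` as a two-sided
unit; hence it makes the free module an associative unital `𝕂`-algebra. -/
theorem nilHecke_coxeter_assoc_unital {B : Type*} {W : Type*} [Group W] [DecidableEq W]
    {M : CoxeterMatrix B} (cs : CoxeterSystem M W) (𝕂 : Type*) [CommRing 𝕂] :
    -- the product on basis elements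
    ∀ nmul : W → W → (W →₀ 𝕂),
      (nmul = fun w w' =>
        if cs.length (w * w') = cs.length w + cs.length w' then
          Finsupp.single (w * w') (1 : 𝕂) else 0) →
    -- its bilinear extension
    ∀ mul : (W →₀ 𝕂) → (W →₀ 𝕂) → (W →₀ 𝕂),
      (mul = fun f g => f.sum fun w a => g.sum fun w' b => (a * b) • nmul w w') →
    -- the product extends the one on basis elements, is associative,
    -- and `n_e` is a two-sided unit
    (∀ w w' : W, mul (Finsupp.single w 1) (Finsupp.single w' 1) = nmul w w') ∧
    (∀ f g h : W →₀ 𝕂, mul (mul f g) h = mul f (mul g h)) ∧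
    (∀ f : W →₀ 𝕂, mul (Finsupp.single (1 : W) (1 : 𝕂)) f = f) ∧
    (∀ f : W →₀ 𝕂, mul f (Finsupp.single (1 : W) (1 : 𝕂)) = f) := by
  intro nmul hn mul hm
  have single_single (u v : W) (a b : 𝕂) :
      mul (Finsupp.single u a) (Finsupp.single v b) =
        if cs.length (u * v) = cs.length u + cs.length v then
          Finsupp.single (u * v) (a * b) else 0 := by
    simp [hm, hn]
  have zero_left (g : W →₀ 𝕂) : mul 0 g = 0 := by simp [hm]
  have zero_right (f : W →₀ 𝕂) : mul f 0 = 0 := by simp [hm]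
  have add_left (f f' g : W →₀ 𝕂) : mul (f + f') g = mul f g + mul f' g := by
    simp only [hm]
    refine Finsupp.sum_add_index' (by simp) fun w a a' => ?_
    simp [add_mul, add_smul, Finsupp.sum_add]
  have add_right (f g g' : W →₀ 𝕂) : mul f (g + g') = mul f g + mul f g' := by
    simp only [hm]
    rw [← Finsupp.sum_add]
    refine Finsupp.sum_congr fun w _ => ?_
    refine Finsupp.sum_add_index' (by simp) fun w' b b' => ?_
    simp [mul_add, add_smul]
  refine ⟨fun w w' => by simp [single_single, hn], fun f g h => ?_, fun f => ?_, fun f => ?_⟩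
  · induction f using Finsupp.induction_linear with
    | zero => simp [zero_left]
    | add f f' hf hf' => simp [add_left, hf, hf']
    | single u a =>
      induction g using Finsupp.induction_linear with
      | zero => simp [zero_left, zero_right]
      | add g g' hg hg' => simp [add_left, add_right, hg, hg']
      | single v b =>
        induction h using Finsupp.induction_linear with
        | zero => simp [zero_right]
        | add h h' hh hh' => simp [add_right, hh, hh']
        | single w c =>
          have key := cs.length_mul_mul_additive_iff u v w
          rw [single_single u v, single_single v w, apply_ite (mul · (Finsupp.single w c)),
            apply_ite (mul (Finsupp.single u a))]
          simp only [single_single, zero_left, zero_right, ← ite_and, mul_assoc a b c,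
            mul_assoc u v w]
          simp only [mul_assoc u v w] at key
          simp only [key]
  · induction f using Finsupp.induction_linear with
    | zero => exact zero_right _
    | add f f' hf hf' => rw [add_right, hf, hf']
    | single w a => simp [single_single]
  · induction f using Finsupp.induction_linear with
    | zero => exact zero_left _
    | add f f' hf hf' => rw [add_left, hf, hf']
    | single w a => simp [single_single]
end

section
/- Let A = (a_{ij})_{i,j∈I} be a generalized Cartan matrix with Weyl group W generated by S = {s_1,…,s_θ}, where s_i acts on ℤ^I by s_i(α_j) = α_j − a_{ij} α_i. Let 𝕂 = ℤ[t_1,…,t_θ], identify α_i with t_i so that W acts on 𝕂 by ring automorphisms, let 𝒩 be the nil-Hecke algebra of the Coxeter system (W,S) over 𝕂, write n_i := n_{s_i}, and for λ ∈ 𝕂 set h_i(λ) := 1 + λ n_i. For w ∈ W with reduced expression w = s_{i_1} ⋯ s_{i_ℓ} (ℓ = ℓ(w)), the element h(w) := h_{i_1}(α_{i_1}) h_{i_2}(s_{i_1}(α_{i_2})) ⋯ h_{i_ℓ}(s_{i_1} ⋯ s_{i_{ℓ−1}}(α_{i_ℓ})) of 𝒩 is independent of the choice of reduced expression of w. -/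
noncomputable section

open MvPolynomial

/-- The Coxeter matrix entry attached to the product `a_{ij} a_{ji}` of off-diagonal
entries of a generalized Cartan matrix: `m = 2, 3, 4, 6, ∞` according as
`a_{ij}a_{ji} = 0, 1, 2, 3, ≥ 4` (Mathlib's convention: `0` codes `∞`). -/
def gcmEntry (p : ℤ) : ℕ :=
  if p = 0 then 2 else if p = 1 then 3 else if p = 2 then 4 else if p = 3 then 6 else 0

/-- The Coxeter matrix of a generalized Cartan matrix. -/
def gcmCoxeterMatrix {θ : ℕ} (A : Matrix (Fin θ) (Fin θ) ℤ) : CoxeterMatrix (Fin θ) where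
  M := Matrix.of fun i j => if i = j then 1 else gcmEntry (A i j * A j i)
  isSymm := by
    unfold Matrix.IsSymm
    ext i j
    by_cases h : i = j <;> simp [h, mul_comm, eq_comm]
  diagonal := by simp
  off_diagonal := by
    intro i j h
    simp only [Matrix.of_apply, if_neg h, gcmEntry]
    split_ifs <;> omega

/-- The action of the simple reflection `s_i` on `𝕂 = ℤ[t_1,…,t_θ]`, extending
`α_j = t_j ↦ t_j - a_{ij} t_i`. -/
def sRefl {θ : ℕ} (A : Matrix (Fin θ) (Fin θ) ℤ) (i : Fin θ) :
    MvPolynomial (Fin θ) ℤ →+* MvPolynomial (Fin θ) ℤ :=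
  (aeval fun j => X j - C (A i j) * X i : MvPolynomial (Fin θ) ℤ →ₐ[ℤ] _).toRingHom

/-- `h(ω) = h_{i_1}(α_{i_1}) h_{i_2}(s_{i_1} α_{i_2}) ⋯` for a word
`ω = [i_1, …, i_m]`, computed in the nil-Hecke algebra with product `mul`;
the ring homomorphism argument accumulates `s_{i_1} ⋯ s_{i_{k-1}}`. -/
def hProd {θ : ℕ} {W : Type*} [Group W] (A : Matrix (Fin θ) (Fin θ) ℤ)
    {M : CoxeterMatrix (Fin θ)} (cs : CoxeterSystem M W)
    (mul : (W →₀ MvPolynomial (Fin θ) ℤ) → (W →₀ MvPolynomial (Fin θ) ℤ) →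
      (W →₀ MvPolynomial (Fin θ) ℤ)) :
    List (Fin θ) → (MvPolynomial (Fin θ) ℤ →+* MvPolynomial (Fin θ) ℤ) →
      (W →₀ MvPolynomial (Fin θ) ℤ)
  | [], _ => Finsupp.single 1 1
  | i :: l, s =>
      mul (Finsupp.single (1 : W) 1 + Finsupp.single (cs.simple i) (s (X i)))
        (hProd A cs mul l (s.comp (sRefl A i)))

namespace NilHecke

section BraidIdentities

variable {G K R : Type*} [Monoid G] [CommRing K] [Ring R] [Algebra K R]

theorem mul_pow_two_eq_one {x y : G} (hx : x * x = 1) (hy : y * y = 1)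
    (h : x * y = y * x) : (x * y) ^ 2 = 1 := by
  have hx' (z : G) : x * (x * z) = z := by rw [← mul_assoc, hx, one_mul]
  have h' (z : G) : x * (y * z) = y * (x * z) := by simp only [← mul_assoc, h]
  simp [pow_succ, mul_assoc, h', hx', hy]

theorem mul_pow_three_eq_one {x y : G} (hx : x * x = 1) (hy : y * y = 1)
    (h : x * (y * x) = y * (x * y)) : (x * y) ^ 3 = 1 := by
  have hx' (z : G) : x * (x * z) = z := by rw [← mul_assoc, hx, one_mul]
  have h' (z : G) : x * (y * (x * z)) = y * (x * (y * z)) := by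
    simpa only [mul_assoc] using congrArg (· * z) h
  simp [pow_succ, mul_assoc, h', hx', hy]

theorem mul_pow_four_eq_one {x y : G} (hx : x * x = 1) (hy : y * y = 1)
    (h : x * (y * (x * y)) = y * (x * (y * x))) : (x * y) ^ 4 = 1 := by
  have hx' (z : G) : x * (x * z) = z := by rw [← mul_assoc, hx, one_mul]
  simp [pow_succ, mul_assoc, h, hx', hy]

theorem mul_pow_six_eq_one {x y : G} (hx : x * x = 1) (hy : y * y = 1)
    (h : x * (y * (x * (y * (x * y)))) = y * (x * (y * (x * (y * x))))) :
    (x * y) ^ 6 = 1 := by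
  have hx' (z : G) : x * (x * z) = z := by rw [← mul_assoc, hx, one_mul]
  simp [pow_succ, mul_assoc, h, hx', hy]

/-- The Yang–Baxter equation of type `A₁ × A₁`. -/
theorem yangBaxter_two (x y : R) (a b : K) (h : x * y = y * x) :
    (1 + a • x) * (1 + b • y) = (1 + b • y) * (1 + a • x) := by
  simp only [mul_add, add_mul, one_mul, mul_one, smul_mul_assoc, mul_smul_comm, smul_add, h]
  module

/-- The Yang–Baxter equation of type `A₂`. -/
theorem yangBaxter_three (x y : R) (a b : K) (hx : x * x = 0) (hy : y * y = 0)
    (h : x * (y * x) = y * (x * y)) :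
    (1 + a • x) * ((1 + (a + b) • y) * (1 + b • x)) =
      (1 + b • y) * ((1 + (a + b) • x) * (1 + a • y)) := by
  simp only [mul_add, add_mul, one_mul, mul_one, smul_mul_assoc, mul_smul_comm, smul_add,
    smul_zero, add_zero, hx, hy, h]
  module

/-- The Yang–Baxter equation of type `B₂`. -/
theorem yangBaxter_four (x y : R) (a b : K) (hx : x * x = 0) (hy : y * y = 0)
    (h : x * (y * (x * y)) = y * (x * (y * x))) :
    (1 + a • x) * ((1 + (a + b) • y) * ((1 + (a + 2 * b) • x) * (1 + b • y))) =
      (1 + b • y) * ((1 + (a + 2 * b) • x) * ((1 + (a + b) • y) * (1 + a • x))) := by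
  have hx' (z : R) : x * (x * z) = 0 := by rw [← mul_assoc, hx, zero_mul]
  have hy' (z : R) : y * (y * z) = 0 := by rw [← mul_assoc, hy, zero_mul]
  simp only [mul_add, add_mul, one_mul, mul_one, smul_mul_assoc, mul_smul_comm, smul_add,
    smul_zero, add_zero, hx, hy, hx', hy', h]
  module

/-- The Yang–Baxter equation of type `G₂`. -/
theorem yangBaxter_six (x y : R) (a b : K) (hx : x * x = 0) (hy : y * y = 0)
    (h : x * (y * (x * (y * (x * y)))) = y * (x * (y * (x * (y * x))))) :
    (1 + a • x) * ((1 + (a + b) • y) * ((1 + (2 * a + 3 * b) • x) *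
        ((1 + (a + 2 * b) • y) * ((1 + (a + 3 * b) • x) * (1 + b • y))))) =
      (1 + b • y) * ((1 + (a + 3 * b) • x) * ((1 + (a + 2 * b) • y) *
        ((1 + (2 * a + 3 * b) • x) * ((1 + (a + b) • y) * (1 + a • x))))) := by
  have hx' (z : R) : x * (x * z) = 0 := by rw [← mul_assoc, hx, zero_mul]
  have hy' (z : R) : y * (y * z) = 0 := by rw [← mul_assoc, hy, zero_mul]
  simp only [mul_add, add_mul, one_mul, mul_one, smul_mul_assoc, mul_smul_comm, smul_add,
    smul_zero, add_zero, hx, hy, hx', hy', h]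
  module

end BraidIdentities

section CoeffMap

variable {θ : ℕ} {W : Type*}

/-- Application of a ring endomorphism to the coefficients. -/
def coeffMap (W : Type*) (s : MvPolynomial (Fin θ) ℤ →+* MvPolynomial (Fin θ) ℤ) :
    AddMonoid.End (W →₀ MvPolynomial (Fin θ) ℤ) :=
  Finsupp.mapRange.addMonoidHom s.toAddMonoidHom

theorem coeffMap_apply (s : MvPolynomial (Fin θ) ℤ →+* MvPolynomial (Fin θ) ℤ)
    (f : W →₀ MvPolynomial (Fin θ) ℤ) (w : W) : coeffMap W s f w = s (f w) :=
  rfl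

theorem coeffMap_single (s : MvPolynomial (Fin θ) ℤ →+* MvPolynomial (Fin θ) ℤ) (w : W)
    (a : MvPolynomial (Fin θ) ℤ) :
    coeffMap W s (Finsupp.single w a) = Finsupp.single w (s a) :=
  Finsupp.mapRange_single (hf := map_zero s)

theorem coeffMap_smul (s : MvPolynomial (Fin θ) ℤ →+* MvPolynomial (Fin θ) ℤ)
    (a : MvPolynomial (Fin θ) ℤ) (f : W →₀ MvPolynomial (Fin θ) ℤ) :
    coeffMap W s (a • f) = s a • coeffMap W s f := by
  ext1 w
  simp [coeffMap_apply]

theorem coeffMap_comp (s s' : MvPolynomial (Fin θ) ℤ →+* MvPolynomial (Fin θ) ℤ)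
    (f : W →₀ MvPolynomial (Fin θ) ℤ) :
    coeffMap W s (coeffMap W s' f) = coeffMap W (s.comp s') f := by
  ext1 w
  simp [coeffMap_apply]

theorem coeffMap_id (f : W →₀ MvPolynomial (Fin θ) ℤ) :
    coeffMap W (RingHom.id _) f = f := by
  ext1 w
  simp [coeffMap_apply]

end CoeffMap

section LeftMul

variable {θ : ℕ} {W : Type*} [Group W] {M : CoxeterMatrix (Fin θ)} (cs : CoxeterSystem M W)

/-- Left multiplication by `n_i` on the nil-Hecke algebra. -/
def leftMul (i : Fin θ) : Module.End (MvPolynomial (Fin θ) ℤ) (W →₀ MvPolynomial (Fin θ) ℤ) :=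
  Finsupp.linearCombination _ fun w =>
    if cs.length (cs.simple i * w) = cs.length w + 1 then Finsupp.single (cs.simple i * w) 1
    else 0

theorem leftMul_single (i : Fin θ) (w : W) (a : MvPolynomial (Fin θ) ℤ) :
    leftMul cs i (Finsupp.single w a) =
      if cs.length (cs.simple i * w) = cs.length w + 1 then
        Finsupp.single (cs.simple i * w) a else 0 := by
  rw [leftMul, Finsupp.linearCombination_single]
  split_ifs <;> simp

theorem prod_leftMul_single (ω : List (Fin θ)) (w : W) (a : MvPolynomial (Fin θ) ℤ) :
    (ω.map (leftMul cs)).prod (Finsupp.single w a) =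
      if cs.length (cs.wordProd ω * w) = ω.length + cs.length w then
        Finsupp.single (cs.wordProd ω * w) a else 0 := by
  induction ω with
  | nil => simp
  | cons i ω ih =>
    have h₁ := cs.length_mul_le (cs.wordProd ω) w
    have h₂ := cs.length_wordProd_le ω
    have h₃ := cs.length_mul_le (cs.simple i) (cs.wordProd ω * w)
    rw [cs.length_simple] at h₃
    rw [List.map_cons, List.prod_cons, Module.End.mul_apply, ih, cs.wordProd_cons, mul_assoc,
      List.length_cons]
    by_cases h : cs.length (cs.wordProd ω * w) = ω.length + cs.length w
    · rw [if_pos h, leftMul_single]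
      refine if_congr ?_ rfl rfl
      omega
    · rw [if_neg h, map_zero, if_neg]
      omega

theorem prod_leftMul_congr {ω ω' : List (Fin θ)} (h : cs.wordProd ω = cs.wordProd ω')
    (hl : ω.length = ω'.length) :
    (ω.map (leftMul cs)).prod = (ω'.map (leftMul cs)).prod := by
  refine Finsupp.lhom_ext fun w a => ?_
  rw [prod_leftMul_single, prod_leftMul_single, h, hl]

theorem leftMul_mul_self (i : Fin θ) : leftMul cs i * leftMul cs i = 0 := by
  refine Finsupp.lhom_ext fun w a => ?_
  have h := prod_leftMul_single cs [i, i] w a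
  rw [if_neg (by simp [CoxeterSystem.wordProd])] at h
  simpa using h

theorem coeffMap_leftMul (s : MvPolynomial (Fin θ) ℤ →+* MvPolynomial (Fin θ) ℤ) (i : Fin θ)
    (f : W →₀ MvPolynomial (Fin θ) ℤ) :
    coeffMap W s (leftMul cs i f) = leftMul cs i (coeffMap W s f) := by
  induction f using Finsupp.induction_linear with
  | zero => simp
  | add f g hf hg => simp only [map_add, hf, hg]
  | single w a =>
    rw [coeffMap_single, leftMul_single, leftMul_single]
    split_ifs
    · rw [coeffMap_single]
    · rw [map_zero]

variable (A : Matrix (Fin θ) (Fin θ) ℤ)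

/-- Left multiplication by the product of the factors `h_{i_k}` attached to a word. -/
def hOp : List (Fin θ) → (MvPolynomial (Fin θ) ℤ →+* MvPolynomial (Fin θ) ℤ) →
    Module.End (MvPolynomial (Fin θ) ℤ) (W →₀ MvPolynomial (Fin θ) ℤ)
  | [], _ => 1
  | [i], s => 1 + s (X i) • leftMul cs i
  | i :: l, s => (1 + s (X i) • leftMul cs i) * hOp l (s.comp (sRefl A i))

theorem hOp_cons (i : Fin θ) (l : List (Fin θ))
    (s : MvPolynomial (Fin θ) ℤ →+* MvPolynomial (Fin θ) ℤ) :
    hOp cs A (i :: l) s = (1 + s (X i) • leftMul cs i) * hOp cs A l (s.comp (sRefl A i)) := by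
  cases l <;> simp [hOp]

/-- The composite of the reflections of a word, acting on polynomials. -/
def reflWord (l : List (Fin θ)) : MvPolynomial (Fin θ) ℤ →+* MvPolynomial (Fin θ) ℤ :=
  (l.map (sRefl A)).foldr RingHom.comp (RingHom.id _)

/-- The operator `h_i(α_i) s_i` on the nil-Hecke algebra. -/
def reflOp (i : Fin θ) : AddMonoid.End (W →₀ MvPolynomial (Fin θ) ℤ) :=
  (1 + (X i : MvPolynomial (Fin θ) ℤ) • leftMul cs i).toAddMonoidHom.comp
    (coeffMap W (sRefl A i))

theorem reflOp_apply (i : Fin θ) (f : W →₀ MvPolynomial (Fin θ) ℤ) :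
    reflOp cs A i f = coeffMap W (sRefl A i) f +
      (X i : MvPolynomial (Fin θ) ℤ) • leftMul cs i (coeffMap W (sRefl A i) f) :=
  rfl

theorem coeffMap_prod_reflOp (l : List (Fin θ))
    (s : MvPolynomial (Fin θ) ℤ →+* MvPolynomial (Fin θ) ℤ)
    (f : W →₀ MvPolynomial (Fin θ) ℤ) :
    coeffMap W s ((l.map (reflOp cs A)).prod f) =
      hOp cs A l s (coeffMap W (s.comp (reflWord A l)) f) := by
  induction l generalizing s with
  | nil => simp [hOp, reflWord]
  | cons i l ih =>
    have h : coeffMap W s (reflOp cs A i ((l.map (reflOp cs A)).prod f)) =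
        (1 + s (X i) • leftMul cs i)
          (coeffMap W (s.comp (sRefl A i)) ((l.map (reflOp cs A)).prod f)) := by
      simp [reflOp_apply, coeffMap_smul, coeffMap_leftMul, coeffMap_comp]
    rw [List.map_cons, List.prod_cons, AddMonoid.End.coe_mul, Function.comp_apply, h, ih, hOp_cons]
    rfl

theorem prod_reflOp_apply (l : List (Fin θ)) (f : W →₀ MvPolynomial (Fin θ) ℤ) :
    (l.map (reflOp cs A)).prod f =
      hOp cs A l (RingHom.id _) (coeffMap W (reflWord A l) f) := by
  simpa only [coeffMap_id, RingHom.id_comp] using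
    coeffMap_prod_reflOp cs A l (RingHom.id _) f

theorem prod_reflOp_congr {l l' : List (Fin θ)}
    (h : hOp cs A l (RingHom.id _) = hOp cs A l' (RingHom.id _))
    (hr : reflWord A l = reflWord A l') :
    (l.map (reflOp cs A)).prod = (l'.map (reflOp cs A)).prod := by
  ext1 f
  rw [prod_reflOp_apply, prod_reflOp_apply, h, hr]

theorem sRefl_X (i j : Fin θ) : sRefl A i (X j) = X j - C (A i j) * X i := by
  simp [sRefl]

theorem sRefl_C (i : Fin θ) (c : ℤ) : sRefl A i (C c) = C c := by
  simp [sRefl]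

theorem sRefl_X_self {i : Fin θ} (h : A i i = 2) : sRefl A i (X i) = -X i := by
  rw [sRefl_X, h, map_ofNat]
  ring

theorem reflOp_mul_self {i : Fin θ} (h : A i i = 2) : reflOp cs A i * reflOp cs A i = 1 := by
  have hl := leftMul_mul_self cs i
  have hprod : hOp cs A [i, i] (RingHom.id _) = hOp cs A [] (RingHom.id _) := by
    simp [hOp, sRefl_X_self A h, mul_add, add_mul, hl]
    module
  have hr : reflWord A [i, i] = reflWord A [] := by
    refine MvPolynomial.ringHom_ext (fun c => ?_) fun k => ?_
    · simp [reflWord]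
    · simp only [reflWord, List.map, List.foldr, RingHom.comp_apply, RingHom.id_apply,
        sRefl_X A i k, map_sub, map_mul, sRefl_C, sRefl_X_self A h]
      ring
  simpa using prod_reflOp_congr cs A hprod hr

end LeftMul

section Braid

variable {θ : ℕ} {W : Type*} [Group W] {M : CoxeterMatrix (Fin θ)} (cs : CoxeterSystem M W)
  (A : Matrix (Fin θ) (Fin θ) ℤ) {i j : Fin θ}

theorem prod_leftMul_alternatingWord {m : ℕ} (hm : M i j = m) :
    ((CoxeterSystem.alternatingWord i j m).map (leftMul cs)).prod =
      ((CoxeterSystem.alternatingWord j i m).map (leftMul cs)).prod := by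
  refine prod_leftMul_congr cs ?_ (by simp)
  have h := cs.wordProd_braidWord_eq i j
  rwa [CoxeterSystem.braidWord, CoxeterSystem.braidWord, M.symmetric j i, hm] at h

theorem reflOp_braid_two (hij : A i j = 0) (hji : A j i = 0) (hm : M i j = 2) :
    reflOp cs A i * reflOp cs A j = reflOp cs A j * reflOp cs A i := by
  have e₁ : sRefl A i (X j) = X j := by simp [sRefl_X, hij]
  have e₂ : sRefl A j (X i) = X i := by simp [sRefl_X, hji]
  have hb := prod_leftMul_alternatingWord cs hm
  simp only [CoxeterSystem.alternatingWord, List.concat_eq_append, List.nil_append,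
    List.cons_append, List.map, List.prod_cons, List.prod_nil, mul_one] at hb
  have hh : hOp cs A [i, j] (RingHom.id _) = hOp cs A [j, i] (RingHom.id _) := by
    simp only [hOp, RingHom.comp_apply, RingHom.id_apply, e₁, e₂]
    exact yangBaxter_two (leftMul cs i) (leftMul cs j) (X i : MvPolynomial (Fin θ) ℤ) (X j) hb
  have hr : reflWord A [i, j] = reflWord A [j, i] := by
    refine MvPolynomial.ringHom_ext (fun c => ?_) fun k => ?_
    · simp [reflWord]
    · simp only [reflWord, List.map, List.foldr, RingHom.comp_apply, RingHom.id_apply,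
        sRefl_X A i k, sRefl_X A j k, map_sub, map_mul, sRefl_C, e₁, e₂]
      ring
  simpa using prod_reflOp_congr cs A hh hr

theorem reflOp_braid_three (hi : A i i = 2) (hj : A j j = 2) (hij : A i j = -1)
    (hji : A j i = -1) (hm : M i j = 3) :
    reflOp cs A i * (reflOp cs A j * reflOp cs A i) =
      reflOp cs A j * (reflOp cs A i * reflOp cs A j) := by
  have e₁ : sRefl A i (X j) = X i + X j := by simp [sRefl_X, hij, add_comm]
  have e₂ : sRefl A j (X i) = X i + X j := by simp [sRefl_X, hji]
  have e₃ := sRefl_X_self A hi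
  have e₄ := sRefl_X_self A hj
  have hb := (prod_leftMul_alternatingWord cs hm).symm
  simp only [CoxeterSystem.alternatingWord, List.concat_eq_append, List.nil_append,
    List.cons_append, List.map, List.prod_cons, List.prod_nil, mul_one] at hb
  have p₃ : sRefl A i (sRefl A j (X i)) = X j := by
    simp only [e₁, e₂, e₃, map_add]
    ring
  have q₃ : sRefl A j (sRefl A i (X j)) = X i := by
    simp only [e₁, e₂, e₄, map_add]
    ring
  have hh : hOp cs A [i, j, i] (RingHom.id _) = hOp cs A [j, i, j] (RingHom.id _) := by
    simp only [hOp, RingHom.comp_apply, RingHom.id_apply]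
    rw [p₃, q₃, e₁, e₂]
    exact yangBaxter_three (leftMul cs i) (leftMul cs j) (X i : MvPolynomial (Fin θ) ℤ) (X j)
      (leftMul_mul_self cs i) (leftMul_mul_self cs j) hb
  have hr : reflWord A [i, j, i] = reflWord A [j, i, j] := by
    refine MvPolynomial.ringHom_ext (fun c => ?_) fun k => ?_
    · simp [reflWord]
    · simp only [reflWord, List.map, List.foldr, RingHom.comp_apply, RingHom.id_apply,
        sRefl_X A i k, sRefl_X A j k, map_sub, map_add, map_mul, sRefl_C, e₁, e₂, e₃, e₄]
      ring
  simpa using prod_reflOp_congr cs A hh hr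

theorem reflOp_braid_four (hi : A i i = 2) (hj : A j j = 2) (hij : A i j = -1)
    (hji : A j i = -2) (hm : M i j = 4) :
    reflOp cs A i * (reflOp cs A j * (reflOp cs A i * reflOp cs A j)) =
      reflOp cs A j * (reflOp cs A i * (reflOp cs A j * reflOp cs A i)) := by
  have e₁ : sRefl A i (X j) = X i + X j := by simp [sRefl_X, hij, add_comm]
  have e₂ : sRefl A j (X i) = X i + 2 * X j := by simp [sRefl_X, hji]
  have e₃ := sRefl_X_self A hi
  have e₄ := sRefl_X_self A hj
  have hb := prod_leftMul_alternatingWord cs hm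
  simp only [CoxeterSystem.alternatingWord, List.concat_eq_append, List.nil_append,
    List.cons_append, List.map, List.prod_cons, List.prod_nil, mul_one] at hb
  have p₃ : sRefl A i (sRefl A j (X i)) = X i + 2 * X j := by
    simp only [e₁, e₂, e₃, map_add, map_mul, map_ofNat]
    ring
  have p₄ : sRefl A i (sRefl A j (sRefl A i (X j))) = X j := by
    simp only [e₁, e₂, e₃, e₄, map_add, map_mul, map_neg, map_ofNat]
    ring
  have q₃ : sRefl A j (sRefl A i (X j)) = X i + X j := by
    simp only [e₁, e₂, e₄, map_add]
    ring
  have q₄ : sRefl A j (sRefl A i (sRefl A j (X i))) = X i := by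
    simp only [e₁, e₂, e₃, e₄, map_add, map_mul, map_neg, map_ofNat]
    ring
  have hh : hOp cs A [i, j, i, j] (RingHom.id _) = hOp cs A [j, i, j, i] (RingHom.id _) := by
    simp only [hOp, RingHom.comp_apply, RingHom.id_apply]
    rw [p₄, q₄, p₃, q₃, e₁, e₂]
    exact yangBaxter_four (leftMul cs i) (leftMul cs j) (X i : MvPolynomial (Fin θ) ℤ) (X j)
      (leftMul_mul_self cs i) (leftMul_mul_self cs j) hb
  have hr : reflWord A [i, j, i, j] = reflWord A [j, i, j, i] := by
    refine MvPolynomial.ringHom_ext (fun c => ?_) fun k => ?_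
    · simp [reflWord]
    · simp only [reflWord, List.map, List.foldr, RingHom.comp_apply, RingHom.id_apply,
        sRefl_X A i k, sRefl_X A j k, map_sub, map_add, map_neg, map_mul, map_ofNat, sRefl_C,
        e₁, e₂, e₃, e₄]
      ring
  simpa using prod_reflOp_congr cs A hh hr

theorem reflOp_braid_six (hi : A i i = 2) (hj : A j j = 2) (hij : A i j = -1)
    (hji : A j i = -3) (hm : M i j = 6) :
    reflOp cs A i * (reflOp cs A j * (reflOp cs A i *
        (reflOp cs A j * (reflOp cs A i * reflOp cs A j)))) =
      reflOp cs A j * (reflOp cs A i * (reflOp cs A j *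
        (reflOp cs A i * (reflOp cs A j * reflOp cs A i)))) := by
  have e₁ : sRefl A i (X j) = X i + X j := by simp [sRefl_X, hij, add_comm]
  have e₂ : sRefl A j (X i) = X i + 3 * X j := by simp [sRefl_X, hji]
  have e₃ := sRefl_X_self A hi
  have e₄ := sRefl_X_self A hj
  have hb := prod_leftMul_alternatingWord cs hm
  simp only [CoxeterSystem.alternatingWord, List.concat_eq_append, List.nil_append,
    List.cons_append, List.map, List.prod_cons, List.prod_nil, mul_one] at hb
  have p₃ : sRefl A i (sRefl A j (X i)) = 2 * X i + 3 * X j := by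
    simp only [e₁, e₂, e₃, map_add, map_mul, map_ofNat]
    ring
  have p₄ : sRefl A i (sRefl A j (sRefl A i (X j))) = X i + 2 * X j := by
    simp only [e₁, e₂, e₃, e₄, map_add, map_mul, map_neg, map_ofNat]
    ring
  have p₅ : sRefl A i (sRefl A j (sRefl A i (sRefl A j (X i)))) = X i + 3 * X j := by
    simp only [e₁, e₂, e₃, e₄, map_add, map_mul, map_neg, map_ofNat]
    ring
  have p₆ : sRefl A i (sRefl A j (sRefl A i (sRefl A j (sRefl A i (X j))))) = X j := by
    simp only [e₁, e₂, e₃, e₄, map_add, map_mul, map_neg, map_ofNat]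
    ring
  have q₃ : sRefl A j (sRefl A i (X j)) = X i + 2 * X j := by
    simp only [e₁, e₂, e₄, map_add]
    ring
  have q₄ : sRefl A j (sRefl A i (sRefl A j (X i))) = 2 * X i + 3 * X j := by
    simp only [e₁, e₂, e₃, e₄, map_add, map_mul, map_neg, map_ofNat]
    ring
  have q₅ : sRefl A j (sRefl A i (sRefl A j (sRefl A i (X j)))) = X i + X j := by
    simp only [e₁, e₂, e₃, e₄, map_add, map_mul, map_neg, map_ofNat]
    ring
  have q₆ : sRefl A j (sRefl A i (sRefl A j (sRefl A i (sRefl A j (X i))))) = X i := by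
    simp only [e₁, e₂, e₃, e₄, map_add, map_mul, map_neg, map_ofNat]
    ring
  have hh : hOp cs A [i, j, i, j, i, j] (RingHom.id _) =
      hOp cs A [j, i, j, i, j, i] (RingHom.id _) := by
    simp only [hOp, RingHom.comp_apply, RingHom.id_apply]
    rw [p₆, q₆, p₅, q₅, p₄, q₄, p₃, q₃, e₁, e₂]
    exact yangBaxter_six (leftMul cs i) (leftMul cs j) (X i : MvPolynomial (Fin θ) ℤ) (X j)
      (leftMul_mul_self cs i) (leftMul_mul_self cs j) hb
  have hr : reflWord A [i, j, i, j, i, j] = reflWord A [j, i, j, i, j, i] := by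
    refine MvPolynomial.ringHom_ext (fun c => ?_) fun k => ?_
    · simp [reflWord]
    · simp only [reflWord, List.map, List.foldr, RingHom.comp_apply, RingHom.id_apply,
        sRefl_X A i k, sRefl_X A j k, map_sub, map_add, map_neg, map_mul, map_ofNat, sRefl_C,
        e₁, e₂, e₃, e₄]
      ring
  simpa using prod_reflOp_congr cs A hh hr

end Braid

theorem eq_neg_one_of_mul_eq_prime {a b : ℤ} (ha : a ≤ 0) {p : ℕ} (hp : p.Prime)
    (h : a * b = p) : (a = -1 ∧ b = -p) ∨ (a = -p ∧ b = -1) := by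
  have hp0 : (p : ℤ) ≠ 0 := by exact_mod_cast hp.ne_zero
  have hn : a.natAbs ∣ p := by
    simpa using Int.natAbs_dvd_natAbs.mpr (Dvd.intro b h)
  rcases (Nat.dvd_prime hp).mp hn with h1 | h1
  · have : a = -1 := by omega
    subst this
    left; omega
  · have : a = -p := by omega
    subst this
    right
    exact ⟨rfl, mul_left_cancel₀ (neg_ne_zero.mpr hp0) (by linarith)⟩

variable {θ : ℕ} {W : Type*} [Group W]

theorem isLiftable_reflOp (A : Matrix (Fin θ) (Fin θ) ℤ) (hdiag : ∀ i, A i i = 2)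
    (hoff : ∀ i j, i ≠ j → A i j ≤ 0) (hzero : ∀ i j, i ≠ j → (A i j = 0 ↔ A j i = 0))
    (cs : CoxeterSystem (gcmCoxeterMatrix A) W) :
    (gcmCoxeterMatrix A).IsLiftable (reflOp cs A) := by
  intro i j
  have hii := reflOp_mul_self cs A (hdiag i)
  have hjj := reflOp_mul_self cs A (hdiag j)
  by_cases hij : i = j
  · subst hij
    rw [hii, one_pow]
  have hM : gcmCoxeterMatrix A i j = gcmEntry (A i j * A j i) := if_neg hij
  have hM' : gcmCoxeterMatrix A j i = gcmEntry (A i j * A j i) := by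
    rw [(gcmCoxeterMatrix A).symmetric j i, hM]
  by_cases h0 : A i j * A j i = 0
  · have hm : gcmEntry (A i j * A j i) = 2 := by simp [gcmEntry, h0]
    rw [hm] at hM
    have hz : A i j = 0 := (mul_eq_zero.mp h0).elim id (hzero i j hij).mpr
    rw [hM]
    exact mul_pow_two_eq_one hii hjj (reflOp_braid_two cs A hz ((hzero i j hij).mp hz) hM)
  by_cases h1 : A i j * A j i = 1
  · have hm : gcmEntry (A i j * A j i) = 3 := by simp [gcmEntry, h1]
    rw [hm] at hM
    have hneg := hoff i j hij
    obtain ⟨ha, hb⟩ : A i j = -1 ∧ A j i = -1 := by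
      rcases Int.mul_eq_one_iff_eq_one_or_neg_one.mp h1 with h | h <;> omega
    rw [hM]
    exact mul_pow_three_eq_one hii hjj
      (reflOp_braid_three cs A (hdiag i) (hdiag j) ha hb hM)
  by_cases h2 : A i j * A j i = 2
  · have hm : gcmEntry (A i j * A j i) = 4 := by simp [gcmEntry, h2]
    rw [hm] at hM hM'
    rw [hM]
    refine mul_pow_four_eq_one hii hjj ?_
    rcases eq_neg_one_of_mul_eq_prime (hoff i j hij) Nat.prime_two h2 with ⟨ha, hb⟩ | ⟨ha, hb⟩
    · exact reflOp_braid_four cs A (hdiag i) (hdiag j) ha hb hM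
    · exact (reflOp_braid_four cs A (hdiag j) (hdiag i) hb ha hM').symm
  by_cases h3 : A i j * A j i = 3
  · have hm : gcmEntry (A i j * A j i) = 6 := by simp [gcmEntry, h3]
    rw [hm] at hM hM'
    rw [hM]
    refine mul_pow_six_eq_one hii hjj ?_
    rcases eq_neg_one_of_mul_eq_prime (hoff i j hij) Nat.prime_three h3 with
      ⟨ha, hb⟩ | ⟨ha, hb⟩
    · exact reflOp_braid_six cs A (hdiag i) (hdiag j) ha hb hM
    · exact (reflOp_braid_six cs A (hdiag j) (hdiag i) hb ha hM').symm
  rw [hM, gcmEntry, if_neg h0, if_neg h1, if_neg h2, if_neg h3, pow_zero]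

theorem hProd_eq_hOp {M : CoxeterMatrix (Fin θ)} (cs : CoxeterSystem M W)
    (A : Matrix (Fin θ) (Fin θ) ℤ)
    {mul : (W →₀ MvPolynomial (Fin θ) ℤ) → (W →₀ MvPolynomial (Fin θ) ℤ) →
      (W →₀ MvPolynomial (Fin θ) ℤ)}
    (hmul : mul = fun f g => f.sum fun w a => g.sum fun w' b => (a * b) •
      (if cs.length (w * w') = cs.length w + cs.length w' then
        Finsupp.single (w * w') (1 : MvPolynomial (Fin θ) ℤ) else 0))
    (l : List (Fin θ)) (s : MvPolynomial (Fin θ) ℤ →+* MvPolynomial (Fin θ) ℤ) :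
    hProd A cs mul l s = hOp cs A l s (Finsupp.single 1 1) := by
  induction l generalizing s with
  | nil => simp [hProd, hOp]
  | cons i l ih =>
    rw [hProd, hOp_cons, ih, Module.End.mul_apply, hmul]
    generalize hOp cs A l _ _ = g
    beta_reduce
    rw [Finsupp.sum_add_index' (by simp)
        (fun w a b => by simp only [add_mul, add_smul, Finsupp.sum_add]),
      Finsupp.sum_single_index (by simp), Finsupp.sum_single_index (by simp)]
    simp only [LinearMap.add_apply, Module.End.one_apply, LinearMap.smul_apply]
    congr 1
    · simp
    · rw [leftMul, Finsupp.linearCombination_apply, Finsupp.smul_sum]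
      simp only [cs.length_simple, mul_smul, add_comm]

end NilHecke

/-- **Independence of reduced expression for `h(w)` in the nil-Hecke algebra of a
generalized Cartan matrix.** If `A` is a generalized Cartan matrix, `(W,S)` the
associated Coxeter system, `𝒩` the nil-Hecke algebra of `(W,S)` over `𝕂 = ℤ[t_1,…,t_θ]`,
and `h_i(λ) = 1 + λ n_i`, then the element
`h(w) = h_{i_1}(α_{i_1}) h_{i_2}(s_{i_1}(α_{i_2})) ⋯ h_{i_ℓ}(s_{i_1}⋯s_{i_{ℓ-1}}(α_{i_ℓ}))`
does not depend on the choice of reduced expression `w = s_{i_1} ⋯ s_{i_ℓ}`. -/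
theorem hProd_independent_of_reduced_word {θ : ℕ} {W : Type*} [Group W] [DecidableEq W]
    (A : Matrix (Fin θ) (Fin θ) ℤ)
    (hdiag : ∀ i, A i i = 2)
    (hoff : ∀ i j, i ≠ j → A i j ≤ 0)
    (hzero : ∀ i j, i ≠ j → (A i j = 0 ↔ A j i = 0))
    (cs : CoxeterSystem (gcmCoxeterMatrix A) W)
    -- the nil-Hecke multiplication over 𝕂 = ℤ[t_1,…,t_θ]
    (mul : (W →₀ MvPolynomial (Fin θ) ℤ) → (W →₀ MvPolynomial (Fin θ) ℤ) →
      (W →₀ MvPolynomial (Fin θ) ℤ))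
    (hmul : mul = fun f g => f.sum fun w a => g.sum fun w' b => (a * b) •
      (if cs.length (w * w') = cs.length w + cs.length w' then
        Finsupp.single (w * w') (1 : MvPolynomial (Fin θ) ℤ) else 0))
    (w : W) (ω ω' : List (Fin θ))
    (hω : cs.wordProd ω = w) (hωred : cs.IsReduced ω)
    (hω' : cs.wordProd ω' = w) (hω'red : cs.IsReduced ω') :
    hProd A cs mul ω (RingHom.id _) = hProd A cs mul ω' (RingHom.id _) := by
  have hlift := NilHecke.isLiftable_reflOp A hdiag hoff hzero cs
  have key (l : List (Fin θ)) : hProd A cs mul l (RingHom.id _) =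
      cs.lift ⟨_, hlift⟩ (cs.wordProd l) (Finsupp.single 1 1) := by
    have hl : cs.lift ⟨_, hlift⟩ (cs.wordProd l) = (l.map (NilHecke.reflOp cs A)).prod := by
      rw [CoxeterSystem.wordProd, map_list_prod, List.map_map]
      congr 2
      ext1 i
      exact cs.lift_apply_simple hlift i
    rw [NilHecke.hProd_eq_hOp cs A hmul, hl, NilHecke.prod_reflOp_apply,
      NilHecke.coeffMap_single, map_one]
  rw [key, key, hω, hω']
end
end

section
/- Let (X, ρ, 𝒞) be a semi-Cartan graph with GRS Δ, Weyl groupoid 𝒲, and nil-Hecke algebra 𝒩 over a commutative ring 𝕂. Let 𝕂𝒲 denote the free 𝕂-module on the set of morphisms of 𝒲. For x ∈ X and i ∈ I define 𝕂-linear maps E^x, L_i^x : 𝕂𝒲 → 𝕂𝒲 on morphisms w by: E^x(w) = w if the target of w is x, and E^x(w) = 0 otherwise; L_i^x(w) = σ_i^x w if σ_i^x w is defined (i.e. the target of w is ρ_i(x)) and ℓ(σ_i^x w) > ℓ(w), and L_i^x(w) = 0 otherwise. Then there exists a (unique) 𝕂-algebra homomorphism Λ : 𝒩 → End_𝕂(𝕂𝒲)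 with Λ(e^x) = E^x and Λ(n_i^x) = L_i^x for all x ∈ X, i ∈ I. -/
open CategoryTheory

noncomputable section

namespace WeylGroupoid

variable {θ : ℕ} {X : Type} [Fintype X] [DecidableEq X]

/-- A *semi-Cartan graph*: a basic datum `(X, ρ)` together with a compatible bundle of
generalized Cartan matrices. -/
structure SCG (θ : ℕ) (X : Type) [Fintype X] [DecidableEq X] : Type where
  nonempty : Nonempty X
  /-- the involutions `ρ_i` of the basic datum -/
  ρ : Fin θ → X → X
  invol : ∀ i x, ρ i (ρ i x) = x
  /-- the bundle of generalized Cartan matrices `C^x` -/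
  C : X → Fin θ → Fin θ → ℤ
  diag : ∀ x i, C x i i = 2
  offdiag : ∀ x i j, i ≠ j → C x i j ≤ 0
  zero_iff : ∀ x i j, i ≠ j → (C x i j = 0 ↔ C x j i = 0)
  compat : ∀ x i j, C (ρ i x) i j = C x i j

/-- the simple root `α_i ∈ ℤ^θ` -/
def al (θ : ℕ) (i : Fin θ) : Fin θ → ℤ := Pi.single i 1

/-- the reflection `s_i^x` of `ℤ^θ`, `s_i^x (α_j) = α_j - c^x_{ij} α_i` -/
def srefl (G : SCG θ X) (x : X) (i : Fin θ) (v : Fin θ → ℤ) : Fin θ → ℤ :=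
  fun k => v k - (if k = i then ∑ j, G.C x i j * v j else 0)

/-- the cone `ℕ₀ α_i + ℕ₀ α_j` -/
def pairCone (θ : ℕ) (i j : Fin θ) : Set (Fin θ → ℤ) :=
  {v | ∃ a b : ℕ, v = (a : ℤ) • al θ i + (b : ℤ) • al θ j}

/-- A *generalized root system* on a semi-Cartan graph. -/
structure GRS (G : SCG θ X) : Type where
  /-- the root sets `Δ^x` -/
  Δ : X → Set (Fin θ → ℤ)
  pos_neg : ∀ x, Δ x = (Δ x ∩ {v | ∀ k, 0 ≤ v k}) ∪ (-(Δ x ∩ {v | ∀ k, 0 ≤ v k}))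
  simple : ∀ x i, Δ x ∩ {v | ∃ c : ℤ, v = c • al θ i} = {al θ i, -al θ i}
  reflect : ∀ x i, (srefl G x i) '' Δ x = Δ (G.ρ i x)
  pairFinite : ∀ x i j, (Δ x ∩ pairCone θ i j).Finite
  loop : ∀ x i j, (fun y => G.ρ i (G.ρ j y))^[(Δ x ∩ pairCone θ i j).ncard] x = x

variable (G : SCG θ X)

/-- The entries `m^x_{ij} = |Δ^x ∩ (ℕ₀α_i + ℕ₀α_j)|`. -/
def mnum (R : GRS G) (x : X) (i j : Fin θ) : ℕ := (R.Δ x ∩ pairCone θ i j).ncard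

/-- the set of positive roots `Δ^x_+` -/
def posRoots (R : GRS G) (x : X) : Set (Fin θ → ℤ) := R.Δ x ∩ {v | ∀ k, 0 ≤ v k}

/-- The objects of the Weyl groupoid (a type synonym for `X` carrying a quiver
structure depending on `G`). -/
def Obj (G : SCG θ X) : Type := X

instance : Quiver (Obj G) := ⟨fun a b => {i : Fin θ // G.ρ i (show X from b) = (show X from a)}⟩

/-- objects of the path category -/
def pob (x : X) : Paths (Obj G) := (x : X)

/-- the generating arrow `σ_i^x : ρ_i(x) → x` -/
def genArrow (x : X) (i : Fin θ) : pob G (G.ρ i x) ⟶ pob G x :=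
  Quiver.Path.nil.cons (⟨i, rfl⟩ : (show Obj G from G.ρ i x) ⟶ (show Obj G from x))

/-- the source of the word `σ_{i_1}^x σ_{i_2} ⋯ σ_{i_m}` (with target `x`) -/
def wsrc (G : SCG θ X) : List (Fin θ) → X → X
  | [], x => x
  | i :: l, x => wsrc G l (G.ρ i x)

/-- the path `σ_{i_1}^x σ_{i_2} ⋯ σ_{i_m} : wsrc(w,x) → x` in the free category -/
def pathOf (G : SCG θ X) : (w : List (Fin θ)) → (x : X) → (pob G (wsrc G w x) ⟶ pob G x)
  | [], _ => 𝟙 _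
  | i :: l, x => (pathOf G l (G.ρ i x)) ≫ genArrow G x i


/-- transport a path along an equality of sources -/
def castSrc {a b c : X} (h : a = b) (f : pob G a ⟶ pob G c) : pob G b ⟶ pob G c := by
  subst h; exact f

/-- the alternating word `[i, j, i, j, …]` of length `n` -/
def altWord (i j : Fin θ) : ℕ → List (Fin θ)
  | 0 => []
  | n + 1 => i :: altWord j i n

/-- The defining relations `(σ_i^x σ_j)^{m^x_{ij}} = id_x` of the Weyl groupoid. -/
inductive wrel (R : GRS G) : HomRel (Paths (Obj G))
  | rel (x : X) (i j : Fin θ)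
      (h : wsrc G (altWord i j (2 * mnum G R x i j)) x = x) :
      wrel R (castSrc G h (pathOf G (altWord i j (2 * mnum G R x i j)) x))
        (𝟙 (pob G x))

variable (R : GRS G)

/-- The Weyl groupoid, as the quotient of the free category on the quiver of the
`σ_i^x` by the relations `(σ_i^x σ_j)^{m^x_{ij}} = id_x` (every generator is invertible
in this quotient, so it is indeed a groupoid). -/
def W := CategoryTheory.Quotient (wrel G R)

instance : Category (W G R) := inferInstanceAs (Category (CategoryTheory.Quotient (wrel G R)))

/-- objects of the Weyl groupoid -/
def objW (x : X) : W G R := ⟨pob G x⟩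

/-- hom-sets `𝒲(y, x)` of the Weyl groupoid -/
def homW (y x : X) := objW G R y ⟶ objW G R x

instance {y x : X} : CoeSort (homW G R y x) (objW G R y ⟶ objW G R x) := ⟨id⟩

/-- the morphism of the Weyl groupoid defined by the word `σ_{i_1}^x ⋯ σ_{i_m}` -/
def morW (w : List (Fin θ)) (x : X) : homW G R (wsrc G w x) x :=
  (Quotient.functor (wrel G R)).map (pathOf G w x)

/-- the generator `σ_i^x : ρ_i(x) → x` in the Weyl groupoid -/
def genW (x : X) (i : Fin θ) : homW G R (G.ρ i x) x :=
  (Quotient.functor (wrel G R)).map (genArrow G x i)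

/-- transport a morphism of the Weyl groupoid along an equality of sources -/
def castW {a b c : X} (h : a = b) (f : homW G R a c) : homW G R b c := by
  subst h; exact f

/-- transport a morphism of the Weyl groupoid along an equality of targets -/
def castTgt {a c c' : X} (h : c = c') (f : homW G R a c) : homW G R a c' := by
  subst h; exact f

/-- the length `ℓ(f)` of a morphism of the Weyl groupoid -/
def len {y x : X} (f : homW G R y x) : ℕ :=
  sInf {n | ∃ w : List (Fin θ), w.length = n ∧
    ∃ h : wsrc G w x = y, castW G R h (morW G R w x) = f}

/-- `w` is a reduced expression of the morphism `f ∈ 𝒲(y,x)` -/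
def IsRedEx (w : List (Fin θ)) {y x : X} (f : homW G R y x) : Prop :=
  ∃ h : wsrc G w x = y, castW G R h (morW G R w x) = f ∧ w.length = len G R f


section NilHecke

variable (𝕂 : Type) [CommRing 𝕂]

/-- the generator `e^x` of the free algebra -/
def eF (x : X) : FreeAlgebra 𝕂 (X ⊕ X × Fin θ) := FreeAlgebra.ι 𝕂 (Sum.inl x)

/-- the generator `n_i^x` of the free algebra -/
def nF (x : X) (i : Fin θ) : FreeAlgebra 𝕂 (X ⊕ X × Fin θ) := FreeAlgebra.ι 𝕂 (Sum.inr (x, i))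

/-- the word `n_{i_1}^x n_{i_2} ⋯ n_{i_m}` in the free algebra
(superscripts determined by composability) -/
def nWF (G : SCG θ X) (𝕂 : Type) [CommRing 𝕂] :
    List (Fin θ) → X → FreeAlgebra 𝕂 (X ⊕ X × Fin θ)
  | [], _ => 1
  | i :: l, x => nF 𝕂 x i * nWF G 𝕂 l (G.ρ i x)

/-- The defining relations of the nil-Hecke algebra of `(X, ρ, 𝒞)`. -/
inductive nrel (R : GRS G) (𝕂 : Type) [CommRing 𝕂] :
    FreeAlgebra 𝕂 (X ⊕ X × Fin θ) → FreeAlgebra 𝕂 (X ⊕ X × Fin θ) → Prop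
  | orth (x y : X) (h : x ≠ y) : nrel R 𝕂 (eF 𝕂 x * eF 𝕂 y) 0
  | idem (x : X) : nrel R 𝕂 (eF 𝕂 x * eF 𝕂 x) (eF 𝕂 x)
  | total : nrel R 𝕂 (∑ x : X, eF 𝕂 x) 1
  | unit_right (x : X) (i : Fin θ) : nrel R 𝕂 (nF 𝕂 x i * eF 𝕂 (G.ρ i x)) (nF 𝕂 x i)
  | unit_left (x : X) (i : Fin θ) : nrel R 𝕂 (eF 𝕂 x * nF 𝕂 x i) (nF 𝕂 x i)
  | nil (x : X) (i : Fin θ) : nrel R 𝕂 (nF 𝕂 (G.ρ i x) i * nF 𝕂 x i) 0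
  | braid (x : X) (i j : Fin θ) (hij : i ≠ j) :
      nrel R 𝕂 (nWF G 𝕂 (altWord i j (mnum G R x i j)) x)
        (nWF G 𝕂 (altWord j i (mnum G R x i j)) x)

/-- The nil-Hecke algebra `𝒩(X, ρ, 𝒞)` of a Weyl groupoid over `𝕂`. -/
def NH := RingQuot (nrel G R 𝕂)

instance : Ring (NH G R 𝕂) := inferInstanceAs (Ring (RingQuot (nrel G R 𝕂)))
instance : Algebra 𝕂 (NH G R 𝕂) := inferInstanceAs (Algebra 𝕂 (RingQuot (nrel G R 𝕂)))

/-- the generator `e^x` of the nil-Hecke algebra -/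
def eN (x : X) : NH G R 𝕂 := RingQuot.mkAlgHom 𝕂 (nrel G R 𝕂) (eF 𝕂 x)

/-- the generator `n_i^x` of the nil-Hecke algebra -/
def nN (x : X) (i : Fin θ) : NH G R 𝕂 := RingQuot.mkAlgHom 𝕂 (nrel G R 𝕂) (nF 𝕂 x i)

/-- the word `n_{i_1}^x n_{i_2} ⋯ n_{i_m}` in the nil-Hecke algebra -/
def nW (w : List (Fin θ)) (x : X) : NH G R 𝕂 := RingQuot.mkAlgHom 𝕂 (nrel G R 𝕂) (nWF G 𝕂 w x)

/-- the set of morphisms of the Weyl groupoid -/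
def Mor := Σ (y : X) (x : X), homW G R y x

/-- the free `𝕂`-module `𝕂𝒲` on the set of morphisms of the Weyl groupoid -/
abbrev KW := Mor G R →₀ 𝕂

/-- the endomorphism `E^x` of `𝕂𝒲` -/
def Emap (x : X) : KW G R 𝕂 →ₗ[𝕂] KW G R 𝕂 :=
  Finsupp.lift (KW G R 𝕂) 𝕂 (Mor G R)
    (fun m => if m.2.1 = x then Finsupp.single m 1 else 0)

/-- the value of the endomorphism `L_i^x` of `𝕂𝒲` on a basis morphism -/
def Lval (x : X) (i : Fin θ) (m : Mor G R) : KW G R 𝕂 :=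
  if h : m.2.1 = G.ρ i x then
    (let f' : homW G R m.1 x := castTgt G R h m.2.2 ≫ genW G R x i
     if len G R m.2.2 < len G R f' then Finsupp.single ⟨m.1, x, f'⟩ 1 else 0)
  else 0

/-- the endomorphism `L_i^x` of `𝕂𝒲` -/
def Lmap (x : X) (i : Fin θ) : KW G R 𝕂 →ₗ[𝕂] KW G R 𝕂 :=
  Finsupp.lift (KW G R 𝕂) 𝕂 (Mor G R) (Lval G R 𝕂 x i)

end NilHecke

end WeylGroupoid


namespace WeylGroupoid

section LeftMultiplication

variable {θ : ℕ} {X : Type} [Fintype X] [DecidableEq X] (G : SCG θ X) (R : GRS G)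

/-- left multiplication of a morphism by the generator `σ_i` composable with it -/
def genMul (i : Fin θ) (m : Mor G R) : Mor G R :=
  ⟨m.1, G.ρ i m.2.1,
    (castTgt G R (G.invol i m.2.1).symm m.2.2 ≫ genW G R (G.ρ i m.2.1) i :
      homW G R m.1 (G.ρ i m.2.1))⟩

/-- left multiplication of a morphism by the word `σ_{i_1} ⋯ σ_{i_m}` -/
def wordMul (w : List (Fin θ)) (m : Mor G R) : Mor G R := w.foldr (genMul G R) m

/-- the identity morphism of `y` as an element of the set of all morphisms -/
def idMor (y : X) : Mor G R := ⟨y, y, (𝟙 (objW G R y) : homW G R y y)⟩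

/-- the length of an element of the set of all morphisms -/
def morLen (m : Mor G R) : ℕ := len G R m.2.2

theorem wordMul_append (u v : List (Fin θ)) (m : Mor G R) :
    wordMul G R (u ++ v) m = wordMul G R u (wordMul G R v m) :=
  List.foldr_append

theorem genMul_eq_of_target_eq (i : Fin θ) (m : Mor G R) (x : X) (h : m.2.1 = G.ρ i x) :
    genMul G R i m = ⟨m.1, x, (castTgt G R h m.2.2 ≫ genW G R x i : homW G R m.1 x)⟩ := by
  have hx : x = G.ρ i m.2.1 := by rw [h, G.invol]
  subst hx
  rfl

theorem genMul_mk (i : Fin θ) (x y : X) (f : homW G R y (G.ρ i x)) :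
    genMul G R i ⟨y, G.ρ i x, f⟩ = ⟨y, x, (f ≫ genW G R x i : homW G R y x)⟩ :=
  genMul_eq_of_target_eq G R i ⟨y, G.ρ i x, f⟩ x rfl

theorem wordMul_mk (w : List (Fin θ)) (x y : X) (f : homW G R y (wsrc G w x)) :
    wordMul G R w ⟨y, wsrc G w x, f⟩ = ⟨y, x, (f ≫ morW G R w x : homW G R y x)⟩ := by
  induction w generalizing x with
  | nil =>
    have h : (f ≫ morW G R [] x : homW G R y x) = f := by
      have h1 : morW G R [] x = 𝟙 (objW G R x) := (Quotient.functor (wrel G R)).map_id _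
      rw [h1]
      exact Category.comp_id _
    rw [h]
    rfl
  | cons i l ih =>
    have h : morW G R (i :: l) x = (morW G R l (G.ρ i x) ≫ genW G R x i : homW G R _ x) :=
      (Quotient.functor (wrel G R)).map_comp _ _
    refine (congrArg (genMul G R i) (ih (G.ρ i x) f)).trans ?_
    refine (genMul_mk G R i x y _).trans ?_
    rw [h]
    exact congrArg (fun g : homW G R y x => (⟨y, x, g⟩ : Mor G R)) (Category.assoc _ _ _)

theorem wordMul_idMor (w : List (Fin θ)) (x : X) :
    wordMul G R w (idMor G R (wsrc G w x)) = ⟨wsrc G w x, x, morW G R w x⟩ := by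
  exact (wordMul_mk G R w x _ _).trans
    (congrArg (fun g : homW G R _ x => (⟨_, x, g⟩ : Mor G R)) (Category.id_comp _))

theorem wsrc_append (u v : List (Fin θ)) (x : X) :
    wsrc G (u ++ v) x = wsrc G v (wsrc G u x) := by
  induction u generalizing x with
  | nil => rfl
  | cons i l ih => exact ih _

theorem wsrc_reverse_wsrc (w : List (Fin θ)) (x : X) :
    wsrc G w.reverse (wsrc G w x) = x := by
  induction w generalizing x with
  | nil => rfl
  | cons i l ih =>
    rw [List.reverse_cons, wsrc_append]
    change G.ρ i (wsrc G l.reverse (wsrc G l (G.ρ i x))) = x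
    rw [ih, G.invol]

theorem wsrc_wsrc_reverse (w : List (Fin θ)) (x : X) :
    wsrc G w (wsrc G w.reverse x) = x := by
  simpa using wsrc_reverse_wsrc G w.reverse x

theorem target_wordMul (w : List (Fin θ)) (m : Mor G R) :
    (wordMul G R w m).2.1 = wsrc G w.reverse m.2.1 := by
  induction w with
  | nil => rfl
  | cons i l ih =>
    rw [List.reverse_cons, wsrc_append, ← ih]
    rfl

theorem castW_eq_iff (w : List (Fin θ)) {y x : X} (f : homW G R y x) :
    (∃ h : wsrc G w x = y, castW G R h (morW G R w x) = f) ↔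
      wordMul G R w (idMor G R y) = ⟨y, x, f⟩ := by
  constructor
  · rintro ⟨rfl, rfl⟩
    exact wordMul_idMor G R w x
  · intro h
    have hx : wsrc G w.reverse y = x := by
      have ht := congrArg (fun m : Mor G R => m.2.1) h
      exact (target_wordMul G R w (idMor G R y)).symm.trans ht
    have hy : wsrc G w x = y := by rw [← hx, wsrc_wsrc_reverse]
    subst hy
    refine ⟨rfl, ?_⟩
    rw [wordMul_idMor] at h
    exact eq_of_heq (Sigma.mk.inj (eq_of_heq (Sigma.mk.inj h).2)).2

theorem morLen_eq (m : Mor G R) :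
    morLen G R m = sInf {n | ∃ w : List (Fin θ), w.length = n ∧
      wordMul G R w (idMor G R m.1) = m} := by
  simp only [morLen, len, castW_eq_iff]
  rfl

theorem exists_wordMul_eq (m : Mor G R) :
    ∃ w : List (Fin θ), wordMul G R w (idMor G R m.1) = m := by
  have key : ∀ (a b : Obj G) (p : Quiver.Path a b), ∃ w : List (Fin θ),
      wordMul G R w (idMor G R a) =
        ⟨a, b, ((Quotient.functor (wrel G R)).map (X := pob G a) (Y := pob G b) p :
          homW G R a b)⟩ := by
    intro a b p
    induction p with
    | nil =>
      refine ⟨[], ?_⟩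
      exact congrArg (fun g : homW G R a a => (⟨a, a, g⟩ : Mor G R))
        ((Quotient.functor (wrel G R)).map_id (pob G a)).symm
    | @cons b c p e ih =>
      obtain ⟨w, hw⟩ := ih
      obtain ⟨i, hi⟩ := e
      change G.ρ i c = b at hi
      subst hi
      refine ⟨i :: w, ?_⟩
      refine (congrArg (genMul G R i) hw).trans ((genMul_mk G R i c a _).trans ?_)
      exact congrArg (fun g : homW G R a c => (⟨a, c, g⟩ : Mor G R))
        ((Quotient.functor (wrel G R)).map_comp (X := pob G a) (Y := pob G (G.ρ i c))
          (Z := pob G c) p (genArrow G c i)).symm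
  obtain ⟨y, x, f⟩ := m
  obtain ⟨p, rfl⟩ := (Quotient.functor (wrel G R)).map_surjective (X := pob G y) (Y := pob G x) f
  exact key y x p

theorem morLen_genMul_le (i : Fin θ) (m : Mor G R) :
    morLen G R (genMul G R i m) ≤ morLen G R m + 1 := by
  obtain ⟨w, hw, hm⟩ : morLen G R m ∈ {n | ∃ w : List (Fin θ), w.length = n ∧
      wordMul G R w (idMor G R m.1) = m} := by
    rw [morLen_eq]
    obtain ⟨w, hw⟩ := exists_wordMul_eq G R m
    exact Nat.sInf_mem ⟨_, w, rfl, hw⟩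
  rw [morLen_eq G R (genMul G R i m)]
  exact Nat.sInf_le ⟨i :: w, by simp [hw], congrArg (genMul G R i) hm⟩

theorem morLen_wordMul_le (w : List (Fin θ)) (m : Mor G R) :
    morLen G R (wordMul G R w m) ≤ morLen G R m + w.length := by
  induction w with
  | nil => rfl
  | cons i l ih =>
    have := morLen_genMul_le G R i (wordMul G R l m)
    change morLen G R (genMul G R i (wordMul G R l m)) ≤ _
    rw [List.length_cons]
    lia

theorem pairCone_comm (i j : Fin θ) : pairCone θ i j = pairCone θ j i := by
  ext v
  constructor <;> rintro ⟨a, b, rfl⟩ <;> exact ⟨b, a, add_comm _ _⟩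

theorem mnum_comm (x : X) (i j : Fin θ) : mnum G R x i j = mnum G R x j i := by
  rw [mnum, mnum, pairCone_comm]

theorem mnum_self (x : X) (i : Fin θ) : mnum G R x i i = 1 := by
  rw [mnum, Set.ncard_eq_one]
  refine ⟨al θ i, Set.eq_singleton_iff_unique_mem.2 ⟨⟨?_, 1, 0, by simp⟩, ?_⟩⟩
  · have h : al θ i ∈ ({al θ i, -al θ i} : Set (Fin θ → ℤ)) := Or.inl rfl
    rw [← R.simple x i] at h
    exact h.1
  · rintro v ⟨hv, a, b, rfl⟩
    have h : (a : ℤ) • al θ i + (b : ℤ) • al θ i ∈ ({al θ i, -al θ i} : Set (Fin θ → ℤ)) := by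
      rw [← R.simple x i]
      exact ⟨hv, a + b, (add_smul _ _ _).symm⟩
    rcases h with h | h
    · exact h
    · have := congrFun h i
      simp only [al, Pi.add_apply, Pi.smul_apply, Pi.single_eq_same, Pi.neg_apply,
        smul_eq_mul, mul_one] at this
      lia

theorem wsrc_altWord_two_mul (i j : Fin θ) (n : ℕ) (x : X) :
    wsrc G (altWord i j (2 * n)) x = (fun y => G.ρ j (G.ρ i y))^[n] x := by
  induction n generalizing x with
  | zero => rfl
  | succ n ih =>
    rw [Function.iterate_succ_apply, ← ih]
    rfl

theorem wsrc_altWord_mnum (x : X) (i j : Fin θ) :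
    wsrc G (altWord i j (2 * mnum G R x i j)) x = x := by
  rw [wsrc_altWord_two_mul, mnum_comm]
  exact R.loop x j i

theorem castW_map {a b c : X} (h : a = b) (f : pob G a ⟶ pob G c) :
    castW G R h ((Quotient.functor (wrel G R)).map f) =
      (Quotient.functor (wrel G R)).map (castSrc G h f) := by
  subst h
  rfl

theorem wordMul_altWord_mnum (i j : Fin θ) (m : Mor G R) :
    wordMul G R (altWord i j (2 * mnum G R m.2.1 i j)) m = m := by
  obtain ⟨y, x, f⟩ := m
  have hs := wsrc_altWord_mnum G R x i j
  have hrel : castW G R hs (morW G R (altWord i j (2 * mnum G R x i j)) x) = 𝟙 (objW G R x) := by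
    rw [morW, castW_map]
    exact (CategoryTheory.Quotient.sound _ (wrel.rel x i j hs)).trans ((Quotient.functor (wrel G R)).map_id _)
  have gen : ∀ (w : List (Fin θ)) (h : wsrc G w x = x),
      castW G R h (morW G R w x) = 𝟙 (objW G R x) →
        wordMul G R w ⟨y, x, f⟩ = ⟨y, x, f⟩ := by
    intro w h hw
    have aux : ∀ (z : X) (hz : wsrc G w x = z) (g : homW G R y z),
        wordMul G R w ⟨y, z, g⟩ = ⟨y, x, (g ≫ castW G R hz (morW G R w x) : homW G R y x)⟩ := by
      rintro z rfl g
      exact wordMul_mk G R w x y g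
    rw [aux x h f, hw]
    exact congrArg (fun g : homW G R y x => (⟨y, x, g⟩ : Mor G R)) (Category.comp_id _)
  exact gen _ hs hrel

theorem genMul_genMul (i : Fin θ) (m : Mor G R) : genMul G R i (genMul G R i m) = m := by
  have h := wordMul_altWord_mnum G R i i m
  rw [mnum_self] at h
  exact h

theorem wordMul_reverse_wordMul (w : List (Fin θ)) (m : Mor G R) :
    wordMul G R w.reverse (wordMul G R w m) = m := by
  induction w with
  | nil => rfl
  | cons i l ih =>
    rw [List.reverse_cons, wordMul_append]
    change wordMul G R l.reverse (genMul G R i (genMul G R i (wordMul G R l m))) = m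
    rw [genMul_genMul, ih]

theorem length_altWord (i j : Fin θ) (n : ℕ) : (altWord i j n).length = n := by
  induction n generalizing i j with
  | zero => rfl
  | succ n ih => simp [altWord, ih]

theorem altWord_succ_eq_append (i j : Fin θ) (n : ℕ) :
    altWord i j (n + 1) = altWord i j n ++ [if Even n then i else j] := by
  induction n generalizing i j with
  | zero => rfl
  | succ n ih =>
    rw [altWord, ih, altWord]
    by_cases h : Even n <;> simp [h, Nat.even_add_one]

theorem altWord_two_mul (i j : Fin θ) (n : ℕ) :
    altWord i j (2 * n) = altWord i j n ++ (altWord j i n).reverse := by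
  induction n generalizing i j with
  | zero => rfl
  | succ n ih =>
    have h : altWord j i (2 * n + 1) = altWord j i (2 * n) ++ [j] := by
      rw [altWord_succ_eq_append, if_pos (even_two_mul n)]
    rw [show 2 * (n + 1) = 2 * n + 1 + 1 by ring, altWord, h, ih]
    simp [altWord]

theorem wsrc_altWord_comm (x : X) (i j : Fin θ) :
    wsrc G (altWord i j (mnum G R x i j)) x = wsrc G (altWord j i (mnum G R x i j)) x := by
  have h := wsrc_altWord_mnum G R x i j
  rw [altWord_two_mul, wsrc_append] at h
  exact (wsrc_wsrc_reverse G _ _).symm.trans (congrArg _ h)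

theorem wordMul_altWord_comm (x : X) (i j : Fin θ) (m : Mor G R)
    (h : wsrc G (altWord j i (mnum G R x i j)) x = m.2.1) :
    wordMul G R (altWord i j (mnum G R x i j)) m =
      wordMul G R (altWord j i (mnum G R x i j)) m := by
  have ht : (wordMul G R (altWord j i (mnum G R x i j)) m).2.1 = x := by
    rw [target_wordMul, ← h, wsrc_reverse_wsrc]
  have hm := wordMul_altWord_mnum G R i j (wordMul G R (altWord j i (mnum G R x i j)) m)
  rwa [ht, altWord_two_mul, wordMul_append, wordMul_reverse_wordMul] at hm

end LeftMultiplication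

section Representation

variable {θ : ℕ} {X : Type} [Fintype X] [DecidableEq X] (G : SCG θ X) (R : GRS G)
  (𝕂 : Type) [CommRing 𝕂]

theorem Emap_single (x : X) (m : Mor G R) :
    Emap G R 𝕂 x (Finsupp.single m 1) = if m.2.1 = x then Finsupp.single m 1 else 0 := by
  simp [Emap]

theorem Lmap_single (x : X) (i : Fin θ) (m : Mor G R) :
    Lmap G R 𝕂 x i (Finsupp.single m 1) =
      if m.2.1 = G.ρ i x ∧ morLen G R m < morLen G R (genMul G R i m) then
        Finsupp.single (genMul G R i m) 1 else 0 := by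
  have hL : Lmap G R 𝕂 x i (Finsupp.single m 1) = Lval G R 𝕂 x i m :=
    (Finsupp.sum_single_index (h := fun m r => r • Lval G R 𝕂 x i m) (zero_smul _ _)).trans
      (one_smul _ _)
  rw [hL, Lval]
  by_cases h : m.2.1 = G.ρ i x
  · rw [dif_pos h, genMul_eq_of_target_eq G R i m x h]
    simp only [h, true_and]
    rfl
  · simp [h]

/-- the composite `L_{i_1}^x L_{i_2} ⋯ L_{i_m}`, superscripts determined by composability -/
def Lword : List (Fin θ) → X → Module.End 𝕂 (KW G R 𝕂)
  | [], _ => 1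
  | i :: l, x => Lmap G R 𝕂 x i * Lword l (G.ρ i x)

theorem Lword_single_of_eq (w : List (Fin θ)) (x : X) (m : Mor G R) (h : wsrc G w x = m.2.1) :
    Lword G R 𝕂 w x (Finsupp.single m 1) =
      if morLen G R (wordMul G R w m) = morLen G R m + w.length then
        Finsupp.single (wordMul G R w m) 1 else 0 := by
  induction w generalizing x with
  | nil => simp [Lword, wordMul]
  | cons i l ih =>
    have ht : (wordMul G R l m).2.1 = G.ρ i x := by
      rw [target_wordMul, ← h]
      exact wsrc_reverse_wsrc G l (G.ρ i x)
    have h1 := morLen_genMul_le G R i (wordMul G R l m)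
    have h2 := morLen_wordMul_le G R l m
    have hw : wordMul G R (i :: l) m = genMul G R i (wordMul G R l m) := rfl
    rw [Lword, Module.End.mul_apply, ih _ h, hw, List.length_cons]
    by_cases hl : morLen G R (wordMul G R l m) = morLen G R m + l.length
    · rw [if_pos hl, Lmap_single]
      refine if_congr ?_ rfl rfl
      rw [and_iff_right ht]
      lia
    · rw [if_neg hl, map_zero, if_neg (by lia)]

theorem Lword_single_of_ne (w : List (Fin θ)) (hw : w ≠ []) (x : X) (m : Mor G R)
    (h : wsrc G w x ≠ m.2.1) : Lword G R 𝕂 w x (Finsupp.single m 1) = 0 := by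
  induction w generalizing x with
  | nil => exact absurd rfl hw
  | cons i l ih =>
    rw [Lword, Module.End.mul_apply]
    by_cases hl : l = []
    · subst hl
      change Lmap G R 𝕂 x i (Finsupp.single m 1) = 0
      rw [Lmap_single, if_neg fun hc => h hc.1.symm]
    · rw [ih hl _ h, map_zero]

theorem Lword_braid (x : X) (i j : Fin θ) :
    Lword G R 𝕂 (altWord i j (mnum G R x i j)) x =
      Lword G R 𝕂 (altWord j i (mnum G R x i j)) x := by
  have hs := wsrc_altWord_comm G R x i j
  refine Finsupp.lhom_ext' fun m => LinearMap.ext_ring ?_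
  change Lword G R 𝕂 _ x (Finsupp.single m 1) = Lword G R 𝕂 _ x (Finsupp.single m 1)
  by_cases h : wsrc G (altWord j i (mnum G R x i j)) x = m.2.1
  · rw [Lword_single_of_eq _ _ _ _ _ _ h, Lword_single_of_eq _ _ _ _ _ _ (hs.trans h),
      wordMul_altWord_comm G R x i j m h, length_altWord, length_altWord]
  · rcases hn : mnum G R x i j with _ | n
    · rfl
    · rw [hn] at h hs
      rw [Lword_single_of_ne _ _ _ _ (by simp [altWord]) _ _ h,
        Lword_single_of_ne _ _ _ _ (by simp [altWord]) _ _ (hs ▸ h)]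

/-- the action of the free algebra on `𝕂𝒲` -/
def freeAction : FreeAlgebra 𝕂 (X ⊕ X × Fin θ) →ₐ[𝕂] Module.End 𝕂 (KW G R 𝕂) :=
  FreeAlgebra.lift 𝕂 (Sum.elim (Emap G R 𝕂) fun p => Lmap G R 𝕂 p.1 p.2)

@[simp]
theorem freeAction_eF (x : X) : freeAction G R 𝕂 (eF 𝕂 x) = Emap G R 𝕂 x := by
  simp [freeAction, eF]

@[simp]
theorem freeAction_nF (x : X) (i : Fin θ) : freeAction G R 𝕂 (nF 𝕂 x i) = Lmap G R 𝕂 x i := by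
  simp [freeAction, nF]

theorem freeAction_nWF (w : List (Fin θ)) (x : X) :
    freeAction G R 𝕂 (nWF G 𝕂 w x) = Lword G R 𝕂 w x := by
  induction w generalizing x with
  | nil => exact map_one _
  | cons i l ih => rw [nWF, map_mul, ih, freeAction_nF, Lword]

theorem freeAction_rel {a b : FreeAlgebra 𝕂 (X ⊕ X × Fin θ)} (h : nrel G R 𝕂 a b) :
    freeAction G R 𝕂 a = freeAction G R 𝕂 b := by
  have ext_single : ∀ {f g : Module.End 𝕂 (KW G R 𝕂)},
      (∀ m, f (Finsupp.single m 1) = g (Finsupp.single m 1)) → f = g := fun hfg =>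
    Finsupp.lhom_ext' fun m => LinearMap.ext_ring (hfg m)
  cases h with
  | orth x y hxy =>
    rw [map_mul, map_zero, freeAction_eF, freeAction_eF]
    refine ext_single fun m => ?_
    rw [Module.End.mul_apply, Emap_single]
    split_ifs with hm
    · rw [Emap_single, if_neg fun hx => hxy (hx.symm.trans hm), LinearMap.zero_apply]
    · rw [map_zero, LinearMap.zero_apply]
  | idem x =>
    rw [map_mul, freeAction_eF]
    refine ext_single fun m => ?_
    rw [Module.End.mul_apply, Emap_single]
    split_ifs with hm
    · rw [Emap_single, if_pos hm]
    · rw [map_zero]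
  | total =>
    rw [map_sum, map_one]
    refine ext_single fun m => ?_
    simp [Emap_single]
  | unit_right x i =>
    rw [map_mul, freeAction_eF, freeAction_nF]
    refine ext_single fun m => ?_
    rw [Module.End.mul_apply, Emap_single]
    split_ifs with hm
    · rfl
    · rw [map_zero, Lmap_single, if_neg fun hc => hm hc.1]
  | unit_left x i =>
    rw [map_mul, freeAction_eF, freeAction_nF]
    refine ext_single fun m => ?_
    rw [Module.End.mul_apply, Lmap_single]
    split_ifs with hm
    · rw [Emap_single, if_pos]
      change G.ρ i m.2.1 = x
      rw [hm.1, G.invol]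
    · rw [map_zero]
  | nil x i =>
    rw [map_mul, map_zero, freeAction_nF, freeAction_nF]
    refine ext_single fun m => ?_
    rw [Module.End.mul_apply, Lmap_single, LinearMap.zero_apply]
    split_ifs with hm
    · rw [Lmap_single, genMul_genMul, if_neg fun hc => lt_asymm hc.2 hm.2]
    · rw [map_zero]
  | braid x i j hij =>
    rw [freeAction_nWF, freeAction_nWF, Lword_braid]

end Representation

/-- **A representation of the nil-Hecke algebra of a Weyl groupoid on `𝕂𝒲`.**
There is a unique `𝕂`-algebra homomorphism `Λ : 𝒩 → End_𝕂(𝕂𝒲)` with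
`Λ(e^x) = E^x` and `Λ(n_i^x) = L_i^x` for all `x ∈ X`, `i ∈ I`. -/
theorem exists_unique_nilHecke_representation {θ : ℕ} {X : Type} [Fintype X] [DecidableEq X]
    (G : SCG θ X) (R : GRS G) (𝕂 : Type) [CommRing 𝕂] :
    ∃! Λ : NH G R 𝕂 →ₐ[𝕂] Module.End 𝕂 (KW G R 𝕂),
      (∀ x : X, Λ (eN G R 𝕂 x) = Emap G R 𝕂 x) ∧
      (∀ (x : X) (i : Fin θ), Λ (nN G R 𝕂 x i) = Lmap G R 𝕂 x i) := by
  refine ⟨RingQuot.liftAlgHom 𝕂 ⟨freeAction G R 𝕂, fun _ _ h => freeAction_rel G R 𝕂 h⟩,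
    ⟨fun x => ?_, fun x i => ?_⟩, ?_⟩
  · exact (RingQuot.liftAlgHom_mkAlgHom_apply 𝕂 _ _ _).trans (freeAction_eF G R 𝕂 x)
  · exact (RingQuot.liftAlgHom_mkAlgHom_apply 𝕂 _ _ _).trans (freeAction_nF G R 𝕂 x i)
  · rintro Λ ⟨hE, hL⟩
    refine RingQuot.ringQuot_ext' 𝕂 _ _ (FreeAlgebra.hom_ext (funext ?_))
    rintro (x | ⟨x, i⟩)
    · exact (hE x).trans ((RingQuot.liftAlgHom_mkAlgHom_apply 𝕂 _ _ _).trans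
        (freeAction_eF G R 𝕂 x)).symm
    · exact (hL x i).trans ((RingQuot.liftAlgHom_mkAlgHom_apply 𝕂 _ _ _).trans
        (freeAction_nF G R 𝕂 x i)).symm

end WeylGroupoid
end
end
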